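/- For any polynomials P, R ∈ ℂ[x_1,x_2,x_3,x_4], the bracket defined on ℂ[x_1,x_2,x_3,x_4] by {x_{σ1},x_{σ2}} = det[[∂P/∂x_{σ3}, ∂P/∂x_{σ4}],[∂R/∂x_{σ3}, ∂R/∂x_{σ4}]] for every even permutation σ of (1,2,3,4), extended as a biderivation, satisfies the Jacobi identity and hence is a Poisson bracket. -/

import Mathlib

open MvPolynomial

/-- The Jacobian (Nambu-type) bracket on `ℂ[x₁,...,x₄]` with Casimirs `P, R`:
the determinant of the Jacobian matrix of `(F, G, P, R)`. On generators it gives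
`{x_{σ1},x_{σ2}} = (∂P/∂x_{σ3})(∂R/∂x_{σ4}) − (∂P/∂x_{σ4})(∂R/∂x_{σ3})` for even σ. -/
noncomputable def br4 (P R F G : MvPolynomial (Fin 4) ℂ) : MvPolynomial (Fin 4) ℂ :=
  Matrix.det (Matrix.of fun i j => pderiv j (![F, G, P, R] i))

theorem MvPolynomial.pderiv_pderiv_comm {σ A : Type*} [CommRing A] (i j : σ)
    (f : MvPolynomial σ A) : pderiv i (pderiv j f) = pderiv j (pderiv i f) := by
  classical
  have h : ⁅pderiv (R := A) i, pderiv (R := A) j⁆ = 0 := by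
    refine MvPolynomial.derivation_ext fun k => ?_
    rw [Derivation.commutator_apply, pderiv_X, pderiv_X]
    simp only [Pi.single_apply]
    split_ifs <;> simp
  rw [← sub_eq_zero, ← Derivation.commutator_apply, h, Derivation.zero_apply]

/-- The `2 × 2` minor of the Jacobian matrix of `(P, R)` in the columns `i, j`. -/
noncomputable def jacobianMinor {σ A : Type*} [CommRing A] (P R : MvPolynomial σ A) (i j : σ) :
    MvPolynomial σ A :=
  pderiv i P * pderiv j R - pderiv j P * pderiv i R

theorem jacobianMinor_swap {σ A : Type*} [CommRing A] (P R : MvPolynomial σ A) (i j : σ) :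
    jacobianMinor P R j i = -jacobianMinor P R i j := by
  simp only [jacobianMinor]
  ring

/-- The vanishing of the Jacobiator of the bivector dual to `dP ∧ dR`. -/
theorem jacobianMinor_jacobiator {σ A : Type*} [CommRing A] (P R : MvPolynomial σ A)
    (i j k l : σ) :
    jacobianMinor P R k l * pderiv j (jacobianMinor P R i l) +
      jacobianMinor P R l j * pderiv k (jacobianMinor P R i l) +
      jacobianMinor P R j k * pderiv l (jacobianMinor P R i l) +
      jacobianMinor P R l k * pderiv i (jacobianMinor P R j l) +
      jacobianMinor P R i l * pderiv k (jacobianMinor P R j l) +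
      jacobianMinor P R k i * pderiv l (jacobianMinor P R j l) +
      jacobianMinor P R j l * pderiv i (jacobianMinor P R k l) +
      jacobianMinor P R l i * pderiv j (jacobianMinor P R k l) +
      jacobianMinor P R i j * pderiv l (jacobianMinor P R k l) = 0 := by
  simp only [jacobianMinor, map_sub, Derivation.leibniz, smul_eq_mul,
    pderiv_pderiv_comm j i, pderiv_pderiv_comm k i, pderiv_pderiv_comm l i,
    pderiv_pderiv_comm k j, pderiv_pderiv_comm l j, pderiv_pderiv_comm l k]
  ring

theorem br4_eq_jacobianMinor (P R F G : MvPolynomial (Fin 4) ℂ) :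
    br4 P R F G =
      jacobianMinor P R 2 3 * jacobianMinor F G 0 1 -
      jacobianMinor P R 1 3 * jacobianMinor F G 0 2 +
      jacobianMinor P R 1 2 * jacobianMinor F G 0 3 +
      jacobianMinor P R 0 3 * jacobianMinor F G 1 2 -
      jacobianMinor P R 0 2 * jacobianMinor F G 1 3 +
      jacobianMinor P R 0 1 * jacobianMinor F G 2 3 := by
  simp [br4, jacobianMinor, Matrix.det_succ_row_zero, Fin.sum_univ_succ, Fin.succAbove]
  ring

theorem br4_swap (P R F G : MvPolynomial (Fin 4) ℂ) : br4 P R F G = -br4 P R G F := by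
  simp only [br4_eq_jacobianMinor, jacobianMinor]
  ring

theorem br4_X_X (P R : MvPolynomial (Fin 4) ℂ) (σ : Equiv.Perm (Fin 4))
    (hσ : Equiv.Perm.sign σ = 1) :
    br4 P R (X (σ 0)) (X (σ 1)) = jacobianMinor P R (σ 2) (σ 3) := by
  have h := Matrix.det_permute' σ
    (Matrix.of fun i j => pderiv j ((![X (σ 0), X (σ 1), P, R] : Fin 4 → MvPolynomial _ ℂ) i))
  rw [hσ, Units.val_one, Int.cast_one, one_mul] at h
  rw [br4, ← h]
  simp [jacobianMinor, Matrix.det_succ_row_zero, Fin.sum_univ_succ, Fin.succAbove, pderiv_X,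
    Pi.single_apply, sub_eq_add_neg]

set_option maxHeartbeats 1000000 in
theorem br4_jacobi (P R F G H : MvPolynomial (Fin 4) ℂ) :
    br4 P R F (br4 P R G H) + br4 P R G (br4 P R H F) + br4 P R H (br4 P R F G) = 0 := by
  let d (i j k : Fin 4) : MvPolynomial (Fin 4) ℂ :=
    pderiv i F * jacobianMinor G H j k + pderiv i G * jacobianMinor H F j k +
      pderiv i H * jacobianMinor F G j k
  have key := congrArg₂ (· + ·)
    (congrArg₂ (· + ·) (congrArg (d 0 1 2 * ·) (jacobianMinor_jacobiator P R 0 1 2 3))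
      (congrArg (d 0 3 1 * ·) (jacobianMinor_jacobiator P R 0 3 1 2)))
    (congrArg₂ (· + ·) (congrArg (d 0 2 3 * ·) (jacobianMinor_jacobiator P R 0 2 3 1))
      (congrArg (d 1 3 2 * ·) (jacobianMinor_jacobiator P R 1 3 2 0)))
  simp only [d, jacobianMinor_swap P R 0 1, jacobianMinor_swap P R 0 2, jacobianMinor_swap P R 0 3,
    jacobianMinor_swap P R 1 2, jacobianMinor_swap P R 1 3, jacobianMinor_swap P R 2 3,
    map_neg] at key
  simp only [br4_eq_jacobianMinor]
  generalize jacobianMinor P R 0 1 = a, jacobianMinor P R 0 2 = b, jacobianMinor P R 0 3 = c,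
    jacobianMinor P R 1 2 = e, jacobianMinor P R 1 3 = f, jacobianMinor P R 2 3 = g at *
  simp only [jacobianMinor, map_sub, map_add, Derivation.leibniz, smul_eq_mul,
    pderiv_pderiv_comm (1 : Fin 4) 0, pderiv_pderiv_comm (2 : Fin 4) 0,
    pderiv_pderiv_comm (3 : Fin 4) 0, pderiv_pderiv_comm (2 : Fin 4) 1,
    pderiv_pderiv_comm (3 : Fin 4) 1, pderiv_pderiv_comm (3 : Fin 4) 2] at key ⊢
  linear_combination key

/-- For any polynomials `P, R`, the Jacobian bracket restricts on generators to the
2×2 minors for even permutations, is skew-symmetric, and satisfies the Jacobi identity,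
hence is a Poisson bracket. -/
theorem stmt_3 (P R : MvPolynomial (Fin 4) ℂ) :
    (∀ σ : Equiv.Perm (Fin 4), Equiv.Perm.sign σ = 1 →
      br4 P R (X (σ 0)) (X (σ 1)) =
        pderiv (σ 2) P * pderiv (σ 3) R - pderiv (σ 3) P * pderiv (σ 2) R) ∧
    (∀ F G : MvPolynomial (Fin 4) ℂ, br4 P R F G = - br4 P R G F) ∧
    (∀ F G H : MvPolynomial (Fin 4) ℂ,
      br4 P R F (br4 P R G H) + br4 P R G (br4 P R H F) + br4 P R H (br4 P R F G) = 0) := by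
  exact ⟨br4_X_X P R, br4_swap P R, br4_jacobi P R⟩
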